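/- Let R be a ring, rad R its Jacobson radical, and π̃: ℙ(R) → ℙ(R/rad R), p ↦ p̄, the surjection induced by the canonical epimorphism R → R/rad R. Then for all p, q, r ∈ ℙ(R): p is adjacent to q via r if and only if p̄ is adjacent to q̄ via r̄. -/

import Mathlib

/-- `p` is a point of the projective line over `R`. -/
def IsPoint (R : Type*) [Ring R] (p : Submodule R (R × R)) : Prop :=
  ∃ g : (Matrix (Fin 2) (Fin 2) R)ˣ,
    p = Submodule.span R {(g.val 0 0, g.val 0 1)}

/-- distant relation -/
def Distant {R : Type*} [Ring R] (p q : Submodule R (R × R)) : Prop :=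
  ∃ g : (Matrix (Fin 2) (Fin 2) R)ˣ,
    p = Submodule.span R {(g.val 0 0, g.val 0 1)} ∧
    q = Submodule.span R {(g.val 1 0, g.val 1 1)}

def DistantSet {R : Type*} [Ring R] (p : Submodule R (R × R)) :
    Set (Submodule R (R × R)) := {x | Distant x p}

def Parallel {R : Type*} [Ring R] (p q : Submodule R (R × R)) : Prop :=
  DistantSet p ⊆ DistantSet q

def AdjacentVia {R : Type*} [Ring R] (p q r : Submodule R (R × R)) : Prop :=
  ¬ Parallel r p ∧ ¬ Parallel r q ∧ DistantSet r ⊆ DistantSet p ∪ DistantSet q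

def Adjacent {R : Type*} [Ring R] (p q : Submodule R (R × R)) : Prop :=
  ∃ r, IsPoint R r ∧ AdjacentVia p q r

/-- The Jacobson radical of a ring: the intersection of all maximal left ideals. -/
def JacobsonRadical (R : Type*) [Ring R] : Set R :=
  {a | ∀ I : Ideal R, I.IsMaximal → a ∈ I}

theorem mapMatrix_surjective {R S m : Type*} [Ring R] [Ring S] [Fintype m] [DecidableEq m]
    {π : R →+* S} (hπ : Function.Surjective π) :
    Function.Surjective (π.mapMatrix (m := m)) := by
  intro N
  choose f hf using hπ
  exact ⟨N.map f, by ext; simp [hf]⟩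

theorem isLocalHom_of_surjective_of_ker_le_jacobson {A B : Type*} [Ring A] [Ring B] (f : A →+* B)
    (hf : Function.Surjective f) (hker : ∀ a, f a = 0 → a ∈ Ideal.jacobson (⊥ : Ideal A)) :
    IsLocalHom f := by
  have left_inv (c : A) (hc : f c = 1) : ∃ s, s * c = 1 := by
    obtain ⟨s, hs⟩ := Ideal.exists_mul_sub_mem_of_sub_one_mem_jacobson c
      (hker (c - 1) (by simp [hc]))
    exact ⟨s, sub_eq_zero.1 hs⟩
  have unit_of_map_one (c : A) (hc : f c = 1) : IsUnit c := by
    obtain ⟨s, hs⟩ := left_inv c hc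
    have hfs : f s = 1 := by simpa [hc] using congrArg f hs
    obtain ⟨t, ht⟩ := left_inv s hfs
    have htc : t = c := by rw [← mul_one t, ← hs, ← mul_assoc, ht, one_mul]
    exact ⟨⟨c, s, htc ▸ ht, hs⟩, rfl⟩
  refine ⟨fun a ha => ?_⟩
  obtain ⟨u, hu⟩ := ha
  obtain ⟨b, hb⟩ := hf ↑u⁻¹
  obtain ⟨v, hv⟩ := unit_of_map_one (a * b) (by rw [map_mul, ← hu, hb, Units.mul_inv])
  obtain ⟨w, hw⟩ := unit_of_map_one (b * a) (by rw [map_mul, ← hu, hb, Units.inv_mul])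
  refine isUnit_iff_exists_and_exists.2 ⟨⟨b * ↑v⁻¹, ?_⟩, ⟨↑w⁻¹ * b, ?_⟩⟩
  · rw [← mul_assoc, ← hv, Units.mul_inv]
  · rw [mul_assoc, ← hw, Units.inv_mul]

theorem isLocalHom_mapMatrix_of_ker_eq_jacobsonRadical {R S : Type*} [Ring R] [Ring S]
    (π : R →+* S) (hπsurj : Function.Surjective π)
    (hπker : ∀ a : R, π a = 0 ↔ a ∈ JacobsonRadical R) :
    IsLocalHom (π.mapMatrix (m := Fin 2)) := by
  refine isLocalHom_of_surjective_of_ker_le_jacobson _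
    (mapMatrix_surjective hπsurj) fun M hM => ?_
  rw [← Ideal.matrix_bot]
  refine Ideal.matrix_jacobson_le _ ((Ideal.mem_matrix _ _ _).2 fun i j =>
    Submodule.mem_sInf.2 fun I hI => ?_)
  exact (hπker _).1 (congrFun (congrFun hM i) j) I hI.2

theorem exists_row_mul_eq_one {R : Type*} [Ring R] (g : (Matrix (Fin 2) (Fin 2) R)ˣ) (i : Fin 2) :
    ∃ x y, g.val i 0 * x + g.val i 1 * y = 1 :=
  ⟨g.inv 0 i, g.inv 1 i, by
    simpa [Matrix.mul_apply] using congrFun (congrFun g.val_inv i) i⟩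

theorem exists_unit_smul_of_span_eq {R : Type*} [Ring R] {a b c d x y z w : R}
    (hab : a * x + b * y = 1) (hcd : c * z + d * w = 1)
    (h : Submodule.span R {(a, b)} = Submodule.span R {(c, d)}) :
    ∃ u : Rˣ, a = u * c ∧ b = u * d := by
  obtain ⟨s, hs⟩ := Submodule.mem_span_singleton.1
    (h ▸ Submodule.mem_span_singleton_self (a, b) : (a, b) ∈ Submodule.span R {(c, d)})
  obtain ⟨t, ht⟩ := Submodule.mem_span_singleton.1
    (h ▸ Submodule.mem_span_singleton_self (c, d) : (c, d) ∈ Submodule.span R {(a, b)})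
  simp only [Prod.smul_mk, smul_eq_mul, Prod.mk.injEq] at hs ht
  obtain ⟨hsa, hsb⟩ := hs
  obtain ⟨htc, htd⟩ := ht
  have hst : s * t = 1 := by
    calc s * t = s * t * (a * x + b * y) := by rw [hab, mul_one]
      _ = s * (t * a) * x + s * (t * b) * y := by noncomm_ring
      _ = 1 := by rw [htc, htd, hsa, hsb, hab]
  have hts : t * s = 1 := by
    calc t * s = t * s * (c * z + d * w) := by rw [hcd, mul_one]
      _ = t * (s * c) * z + t * (s * d) * w := by noncomm_ring
      _ = 1 := by rw [hsa, hsb, htc, htd, hcd]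
  exact ⟨⟨s, t, hst, hts⟩, hsa.symm, hsb.symm⟩

theorem distant_span_row_iff {R : Type*} [Ring R] (g k : (Matrix (Fin 2) (Fin 2) R)ˣ) :
    Distant (Submodule.span R {(g.val 0 0, g.val 0 1)})
        (Submodule.span R {(k.val 0 0, k.val 0 1)}) ↔
      IsUnit !![g.val 0 0, g.val 0 1; k.val 0 0, k.val 0 1] := by
  constructor
  · rintro ⟨h, h₀, h₁⟩
    obtain ⟨x, y, hg⟩ := exists_row_mul_eq_one g 0
    obtain ⟨z, w, hk⟩ := exists_row_mul_eq_one k 0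
    obtain ⟨x₀, y₀, hh₀⟩ := exists_row_mul_eq_one h 0
    obtain ⟨x₁, y₁, hh₁⟩ := exists_row_mul_eq_one h 1
    obtain ⟨s, hs, hs'⟩ := exists_unit_smul_of_span_eq hg hh₀ h₀
    obtain ⟨t, ht, ht'⟩ := exists_unit_smul_of_span_eq hk hh₁ h₁
    have hd : IsUnit !![(s : R), 0; 0, (t : R)] :=
      ⟨⟨!![(s : R), 0; 0, (t : R)], !![(↑s⁻¹ : R), 0; 0, (↑t⁻¹ : R)],
        by simp [Matrix.one_fin_two],
        by simp [Matrix.one_fin_two]⟩, rfl⟩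
    convert hd.mul h.isUnit using 1
    rw [Matrix.eta_fin_two h.val, Matrix.mul_fin_two, hs, hs', ht, ht']
    simp
  · rintro ⟨h, hh⟩
    exact ⟨h, by simp [hh], by simp [hh]⟩

theorem Distant.isPoint_left {R : Type*} [Ring R] {p q : Submodule R (R × R)}
    (h : Distant p q) : IsPoint R p :=
  h.imp fun _ hg => hg.1

section InducedMap

variable {R S : Type*} [Ring R] [Ring S] {π : R →+* S}
  {Φ : Submodule R (R × R) → Submodule S (S × S)}

theorem map_span_row
    (hΦ : ∀ a b : R, IsPoint R (Submodule.span R {(a, b)}) →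
      Φ (Submodule.span R {(a, b)}) = Submodule.span S {(π a, π b)})
    (g : (Matrix (Fin 2) (Fin 2) R)ˣ) :
    Φ (Submodule.span R {(g.val 0 0, g.val 0 1)}) =
      Submodule.span S {((Units.map (π.mapMatrix (m := Fin 2)).toMonoidHom g).val 0 0,
        (Units.map (π.mapMatrix (m := Fin 2)).toMonoidHom g).val 0 1)} :=
  hΦ _ _ ⟨g, rfl⟩

theorem distant_map_iff [IsLocalHom (π.mapMatrix (m := Fin 2))]
    (hΦ : ∀ a b : R, IsPoint R (Submodule.span R {(a, b)}) →
      Φ (Submodule.span R {(a, b)}) = Submodule.span S {(π a, π b)})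
    {p q : Submodule R (R × R)} (hp : IsPoint R p) (hq : IsPoint R q) :
    Distant (Φ p) (Φ q) ↔ Distant p q := by
  obtain ⟨g, rfl⟩ := hp
  obtain ⟨k, rfl⟩ := hq
  rw [map_span_row hΦ, map_span_row hΦ, distant_span_row_iff, distant_span_row_iff,
    ← isUnit_map_iff (π.mapMatrix (m := Fin 2))]
  refine iff_of_eq (congrArg IsUnit ?_)
  ext i j
  fin_cases i <;> fin_cases j <;> rfl

theorem exists_isPoint_map_eq [IsLocalHom (π.mapMatrix (m := Fin 2))]
    (hπsurj : Function.Surjective π)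
    (hΦ : ∀ a b : R, IsPoint R (Submodule.span R {(a, b)}) →
      Φ (Submodule.span R {(a, b)}) = Submodule.span S {(π a, π b)})
    {y : Submodule S (S × S)} (hy : IsPoint S y) : ∃ x, IsPoint R x ∧ Φ x = y := by
  obtain ⟨g, rfl⟩ := hy
  obtain ⟨M, hM⟩ := mapMatrix_surjective hπsurj g.val
  obtain ⟨k, rfl⟩ : IsUnit M :=
    isUnit_of_map_unit (π.mapMatrix (m := Fin 2)) M ⟨g, hM.symm⟩
  refine ⟨_, ⟨k, rfl⟩, ?_⟩
  rw [hΦ _ _ ⟨k, rfl⟩, ← hM]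
  rfl

theorem distantSet_map_subset_union_iff [IsLocalHom (π.mapMatrix (m := Fin 2))]
    (hπsurj : Function.Surjective π)
    (hΦ : ∀ a b : R, IsPoint R (Submodule.span R {(a, b)}) →
      Φ (Submodule.span R {(a, b)}) = Submodule.span S {(π a, π b)})
    {p q r : Submodule R (R × R)} (hp : IsPoint R p) (hq : IsPoint R q) (hr : IsPoint R r) :
    DistantSet (Φ r) ⊆ DistantSet (Φ p) ∪ DistantSet (Φ q) ↔
      DistantSet r ⊆ DistantSet p ∪ DistantSet q := by
  constructor
  · intro h x (hx : Distant x r)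
    have hx' := hx.isPoint_left
    exact (h ((distant_map_iff hΦ hx' hr).2 hx)).imp
      (distant_map_iff hΦ hx' hp).1 (distant_map_iff hΦ hx' hq).1
  · intro h y (hy : Distant y (Φ r))
    obtain ⟨x, hx, rfl⟩ := exists_isPoint_map_eq hπsurj hΦ hy.isPoint_left
    exact (h ((distant_map_iff hΦ hx hr).1 hy)).imp
      (distant_map_iff hΦ hx hp).2 (distant_map_iff hΦ hx hq).2

theorem parallel_map_iff [IsLocalHom (π.mapMatrix (m := Fin 2))]
    (hπsurj : Function.Surjective π)
    (hΦ : ∀ a b : R, IsPoint R (Submodule.span R {(a, b)}) →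
      Φ (Submodule.span R {(a, b)}) = Submodule.span S {(π a, π b)})
    {p q : Submodule R (R × R)} (hp : IsPoint R p) (hq : IsPoint R q) :
    Parallel (Φ p) (Φ q) ↔ Parallel p q := by
  simpa using! distantSet_map_subset_union_iff hπsurj hΦ hq hq hp

end InducedMap

/-- With `π : R → R̄ = R/rad R` the canonical epimorphism and
`Φ = π̃ : ℙ(R) → ℙ(R̄)` the induced surjection, for all points `p, q, r` of `ℙ(R)`:
`p ∼ q` via `r` iff `Φ p ∼ Φ q` via `Φ r`. -/
theorem stmt_3 {R S : Type*} [Ring R] [Ring S] (π : R →+* S)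
    (hπsurj : Function.Surjective π)
    (hπker : ∀ a : R, π a = 0 ↔ a ∈ JacobsonRadical R)
    (Φ : Submodule R (R × R) → Submodule S (S × S))
    (hΦ : ∀ a b : R, IsPoint R (Submodule.span R {(a, b)}) →
      Φ (Submodule.span R {(a, b)}) = Submodule.span S {(π a, π b)})
    (p q r : Submodule R (R × R)) (hp : IsPoint R p) (hq : IsPoint R q) (hr : IsPoint R r) :
    AdjacentVia p q r ↔ AdjacentVia (Φ p) (Φ q) (Φ r) := by
  have := isLocalHom_mapMatrix_of_ker_eq_jacobsonRadical π hπsurj hπker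
  unfold AdjacentVia
  rw [parallel_map_iff hπsurj hΦ hr hp, parallel_map_iff hπsurj hΦ hr hq,
    distantSet_map_subset_union_iff hπsurj hΦ hp hq hr]
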